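/- Let b be an extreme point of the closed unit ball of H^∞ (that is, ∫_𝕋 log(1 − |b|) dm = −∞) and let E = {ζ ∈ 𝕋 : |b(ζ)| < 1}. If g ∈ L²(E) satisfies ∫_𝕋 ζ̄ⁿ g(ζ) √(1 − |b(ζ)|²) dm(ζ) = 0 for every integer n ≥ 0, then g = 0 a.e. on 𝕋. Equivalently, the projection onto the first coordinate is injective on the orthogonal complement of K = {(bh, √(1 − |b|²) h) : h ∈ H²} in H² ⊕ L²(E). -/

import Mathlib

/-!
Statement 5: Let `b` be an extreme point of the closed unit ball of `H^∞`
(`∫_𝕋 log(1-|b|) dm = -∞`) and `E = {ζ ∈ 𝕋 : |b(ζ)| < 1}`. If `g ∈ L²(E)`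
satisfies `∫_𝕋 ζ̄ⁿ g(ζ) √(1-|b(ζ)|²) dm(ζ) = 0` for every `n ≥ 0`, then
`g = 0` (i.e. the projection onto the first coordinate is injective on `K^⊥`).
-/

open MeasureTheory Complex Metric Filter Set
open scoped Real ENNReal Topology ComplexConjugate

noncomputable section

instance fact_two_pi : Fact (0 < 2 * Real.pi) := ⟨by positivity⟩

abbrev CircT := AddCircle (2 * Real.pi)
abbrev m : Measure CircT := AddCircle.haarAddCircle
abbrev L2 := Lp ℂ 2 m

/-- The point `e^{iθ}` of the unit circle in `ℂ` corresponding to `θ`. -/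
def pt (θ : CircT) : ℂ := (AddCircle.toCircle θ : ℂ)

/-- `-log x`, valued in `[0,∞]`, with value `∞` for `x ≤ 0`; used to express
`∫ log(1-|b|) dm = -∞` as `∫⁻ negLogNN (1-|b|) dm = ∞`. -/
def negLogNN (x : ℝ) : ℝ≥0∞ := if x ≤ 0 then ⊤ else ENNReal.ofReal (-Real.log x)

lemma negLogNN_meas : Measurable negLogNN := by
  unfold negLogNN
  refine Measurable.ite measurableSet_Iic measurable_const ?_
  exact (Real.measurable_log.neg).ennreal_ofReal

lemma pt_cont : Continuous pt := by
  unfold pt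
  exact continuous_subtype_val.comp AddCircle.continuous_toCircle

lemma pt_inj : Function.Injective pt := by
  intro x y h
  exact AddCircle.injective_toCircle (by positivity) (Subtype.ext h)

lemma pt_mk (x : ℝ) : pt (x : CircT) = circleMap 0 1 x := by
  simp [pt, AddCircle.toCircle_apply_mk, circleMap, Circle.coe_exp]

lemma integrable_m_of {f : CircT → ℝ} (hf : Measurable f)
    (h : IntervalIntegrable (fun x : ℝ => f (x : CircT)) volume 0 (2 * Real.pi)) :
    Integrable f m := by
  have h1 : Integrable f (volume : Measure CircT) := by
    have hmp := AddCircle.measurePreserving_mk (2 * Real.pi) 0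
    rw [← hmp.integrable_comp hf.aestronglyMeasurable]
    rw [intervalIntegrable_iff_integrableOn_Ioc_of_le (by positivity)] at h
    rw [zero_add]
    exact h
  rw [AddCircle.volume_eq_smul_haarAddCircle] at h1
  rwa [integrable_smul_measure (by simp [Real.pi_pos]) ENNReal.ofReal_ne_top] at h1

lemma poly_log (p : Polynomial ℂ) :
    Integrable (fun θ => Real.log ‖p.eval (pt θ)‖) m ∧
    ∫ θ, Real.log ‖p.eval (pt θ)‖ ∂m = p.logMahlerMeasure := by
  have hmeas : Measurable (fun θ => Real.log ‖p.eval (pt θ)‖) :=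
    Real.measurable_log.comp (p.continuous.comp pt_cont).norm.measurable
  constructor
  · apply integrable_m_of hmeas
    simpa only [pt_mk] using p.intervalIntegrable_mahlerMeasure
  · rw [AddCircle.integral_haarAddCircle, ← AddCircle.intervalIntegral_preimage _ 0,
      Polynomial.logMahlerMeasure_def, Real.circleAverage_def]
    simp only [pt_mk, zero_add]

lemma m_finite {s : Set CircT} (hs : s.Finite) : m s = 0 := by
  have : ∀ x : CircT, m {x} = 0 := by
    intro x
    have h := AddCircle.volume_closedBall (T := 2 * Real.pi) (x := x) 0
    rw [Metric.closedBall_zero, AddCircle.volume_eq_smul_haarAddCircle, mul_zero,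
      min_eq_right (by positivity), ENNReal.ofReal_zero, Measure.smul_apply, smul_eq_mul,
      mul_eq_zero] at h
    exact h.resolve_left (by simp [Real.pi_pos])
  rw [← Set.biUnion_of_singleton s, measure_biUnion_null_iff hs.countable]
  exact fun x _ => this x

lemma poly_bound (p : Polynomial ℂ) (hp : p ≠ 0) :
    ∫⁻ θ, negLogNN ‖p.eval (pt θ)‖ ∂m ≤
      ∫⁻ θ, ‖p.eval (pt θ)‖ₑ ∂m + ENNReal.ofReal (-Real.log ‖p.leadingCoeff‖) := by
  obtain ⟨hi, he⟩ := poly_log p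
  have hc : Continuous (fun θ => p.eval (pt θ)) := p.continuous.comp pt_cont
  have hi2 : Integrable (fun θ => p.eval (pt θ)) m := by
    rw [← integrableOn_univ]; exact hc.continuousOn.integrableOn_compact isCompact_univ
  have hne : ∀ᵐ θ ∂m, p.eval (pt θ) ≠ 0 := by
    have hfin : {θ : CircT | ¬ p.eval (pt θ) ≠ 0}.Finite := by
      have : {θ : CircT | ¬ p.eval (pt θ) ≠ 0} = pt ⁻¹' {z | p.IsRoot z} := by
        ext; simp [Polynomial.IsRoot]
      rw [this]
      exact (Polynomial.finite_setOfPred_isRoot hp).preimage pt_inj.injOn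
    rw [ae_iff]
    exact m_finite hfin
  have h1 : ∫⁻ θ, negLogNN ‖p.eval (pt θ)‖ ∂m ≤
      ∫⁻ θ, ENNReal.ofReal (‖p.eval (pt θ)‖ - Real.log ‖p.eval (pt θ)‖) ∂m := by
    apply lintegral_mono_ae
    filter_upwards [hne] with θ hθ
    have : 0 < ‖p.eval (pt θ)‖ := norm_pos_iff.2 hθ
    rw [negLogNN, if_neg (not_le.2 this)]
    exact ENNReal.ofReal_le_ofReal (by linarith)
  have h0 : ∀ᵐ θ ∂m, 0 ≤ ‖p.eval (pt θ)‖ - Real.log ‖p.eval (pt θ)‖ := by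
    filter_upwards [] with θ
    linarith [Real.log_le_self (norm_nonneg (p.eval (pt θ)))]
  refine h1.trans ?_
  have h6 := ofReal_integral_eq_lintegral_ofReal (hi2.norm.sub hi) h0
  simp only [Pi.sub_apply] at h6
  rw [← h6, integral_sub hi2.norm hi, he,
    ← ofReal_integral_norm_eq_lintegral_enorm hi2, sub_eq_add_neg]
  refine ENNReal.ofReal_add_le.trans ?_
  gcongr
  rw [Polynomial.logMahlerMeasure_eq_log_MahlerMeasure]
  exact Real.log_le_log (by simpa using hp) p.leadingCoeff_le_mahlerMeasure

lemma negLogNN_tendsto {x : ℝ} (hx : 0 ≤ x) {u : ℕ → ℝ} (hu : Tendsto u atTop (𝓝 x)) :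
    Tendsto (fun n => negLogNN (u n)) atTop (𝓝 (negLogNN x)) := by
  rcases hx.eq_or_lt with rfl | hx
  · have : negLogNN 0 = ⊤ := by simp [negLogNN]
    rw [this, ENNReal.tendsto_nhds_top_iff_nnreal]
    intro K
    have : ∀ᶠ n in atTop, u n < Real.exp (-(K + 1)) := hu.eventually_lt_const (Real.exp_pos _)
    filter_upwards [this] with n hn
    unfold negLogNN
    split_ifs with h
    · simp
    · push Not at h
      have h2 := Real.log_lt_log h hn
      rw [Real.log_exp] at h2
      rw [ENNReal.lt_ofReal_iff_toReal_lt (by simp)]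
      simp; linarith
  · have h1 : negLogNN x = ENNReal.ofReal (-Real.log x) := by simp [negLogNN, hx]
    rw [h1]
    have h2 : Tendsto (fun n => ENNReal.ofReal (-Real.log (u n))) atTop
        (𝓝 (ENNReal.ofReal (-Real.log x))) :=
      ENNReal.tendsto_ofReal (hu.log hx.ne').neg
    refine h2.congr' ?_
    filter_upwards [hu.eventually_const_lt hx] with n hn
    simp [negLogNN, hn]

lemma fourier_pt (n : ℕ) (θ : CircT) : fourier (-(n:ℤ)) θ = (starRingEnd ℂ) (pt θ) ^ n := by
  rw [fourier_neg, ← map_pow]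
  congr 1
  rw [fourier_apply, natCast_zsmul, AddCircle.toCircle_nsmul]
  simp [pt]

lemma norm_pt (θ : CircT) : ‖pt θ‖ = 1 := by
  unfold pt
  exact Circle.norm_coe _

/-- the polynomial associated with a partial sum -/
def pp (d : ℕ → ℂ) (N : ℕ) : Polynomial ℂ :=
  ∑ j ∈ Finset.range (N + 1), Polynomial.monomial (N - j) (d j)

lemma pp_coeff (d : ℕ → ℂ) (N : ℕ) : (pp d N).coeff N = d 0 := by
  simp only [pp, Polynomial.finsetSum_coeff, Polynomial.coeff_monomial]
  rw [Finset.sum_eq_single 0]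
  · simp
  · intro j hj hj0
    rw [Finset.mem_range] at hj
    rw [if_neg (by omega)]
  · simp

lemma pp_lead (d : ℕ → ℂ) (hd : d 0 ≠ 0) (N : ℕ) : (pp d N).leadingCoeff = d 0 := by
  have h1 : (pp d N).natDegree ≤ N := by
    apply Polynomial.natDegree_sum_le_of_forall_le
    intro j _
    exact (Polynomial.natDegree_monomial_le _).trans (Nat.sub_le _ _)
  have h2 := Polynomial.natDegree_eq_of_le_of_coeff_ne_zero h1 (by rwa [pp_coeff])
  rw [Polynomial.leadingCoeff, h2, pp_coeff]

lemma pp_eval (d : ℕ → ℂ) (N k : ℕ) (θ : CircT) :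
    ‖∑ j ∈ Finset.range (N + 1), d j * fourier (-((j + k : ℕ) : ℤ)) θ‖ =
      ‖(pp d N).eval (pt θ)‖ := by
  have : (pp d N).eval (pt θ) = pt θ ^ (N + k) *
      ∑ j ∈ Finset.range (N + 1), d j * fourier (-((j + k : ℕ) : ℤ)) θ := by
    rw [pp, Polynomial.eval_finsetSum, Finset.mul_sum]
    refine Finset.sum_congr rfl fun j hj => ?_
    rw [Finset.mem_range] at hj
    rw [Polynomial.eval_monomial, fourier_pt]
    have h1 : pt θ * (starRingEnd ℂ) (pt θ) = 1 := by
      rw [Complex.mul_conj, Complex.normSq_eq_norm_sq, norm_pt]; simp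
    have h2 : N + k = (N - j) + (j + k) := by omega
    rw [h2, pow_add]
    calc d j * pt θ ^ (N - j) = d j * pt θ ^ (N - j) * (pt θ * (starRingEnd ℂ) (pt θ)) ^ (j + k) := by
          rw [h1]; simp
      _ = _ := by rw [mul_pow]; ring
  rw [this, norm_mul, norm_pow, norm_pt]; simp

lemma key (F : L2) (hF : ∀ n : ℕ, fourierCoeff F (n : ℤ) = 0) (hne : F ≠ 0) :
    ∫⁻ θ, negLogNN ‖F θ‖ ∂m < ⊤ := by
  classical
  have hs := hasSum_fourier_series_L2 F
  have hex : ∃ k : ℕ, fourierCoeff F (-(k : ℤ)) ≠ 0 := by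
    by_contra! hcon
    apply hne
    have hz : ∀ i : ℤ, fourierCoeff F i = 0 := by
      intro i
      obtain ⟨n, rfl | rfl⟩ := i.eq_nat_or_neg
      · exact hF n
      · exact hcon n
    simp only [hz, zero_smul] at hs
    exact hs.unique hasSum_zero
  set k := Nat.find hex with hk
  have hk1 : fourierCoeff F (-(k : ℤ)) ≠ 0 := Nat.find_spec hex
  have hk2 : ∀ j < k, fourierCoeff F (-(j : ℤ)) = 0 := fun j hj => by
    simpa using Nat.find_min hex hj
  let ι : ℕ → ℤ := fun j => -((j + k : ℕ) : ℤ)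
  have hι : Function.Injective ι := by
    intro a b h; simp only [ι] at h; omega
  have hs2 : HasSum ((fun i => fourierCoeff F i • fourierLp 2 i) ∘ ι) F := by
    rw [hι.hasSum_iff]
    · exact hs
    · intro i hi
      have : fourierCoeff F i = 0 := by
        obtain ⟨n, rfl | rfl⟩ := i.eq_nat_or_neg
        · exact hF n
        · apply hk2
          by_contra hlt
          exact hi ⟨n - k, by simp only [ι]; omega⟩
      simp [this]
  let d : ℕ → ℂ := fun j => fourierCoeff F (ι j)
  have hd : d 0 ≠ 0 := by simpa [d, ι] using hk1
  let S : ℕ → L2 := fun N => ∑ j ∈ Finset.range (N + 1), d j • fourierLp 2 (ι j)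
  have hS : Tendsto S atTop (𝓝 F) := (hs2.tendsto_sum_nat).comp (tendsto_add_atTop_nat 1)
  have hSae : ∀ N, ∀ᵐ θ ∂m, ‖S N θ‖ = ‖(pp d N).eval (pt θ)‖ := by
    intro N
    have h1 : ∀ᵐ θ ∂m, ∀ j, fourierLp 2 (ι j) θ = fourier (ι j) θ :=
      ae_all_iff.2 fun j => coeFn_fourierLp 2 (ι j)
    have h2 : ∀ᵐ θ ∂m, ∀ j, (d j • fourierLp 2 (ι j) : L2) θ = d j • fourierLp 2 (ι j) θ :=
      ae_all_iff.2 fun j => Lp.coeFn_smul _ _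
    have h3 := Lp.coeFn_finsetSum (Finset.range (N + 1)) (fun j => (d j • fourierLp 2 (ι j) : L2))
    filter_upwards [h1, h2, h3] with θ h1 h2 h3
    rw [← pp_eval d N k]
    simp only [S]
    rw [h3]
    rw [Finset.sum_apply]
    simp only [h1, h2, smul_eq_mul, ι]
  obtain ⟨ns, hns, hae⟩ := (tendstoInMeasure_of_tendsto_Lp hS).exists_seq_tendsto_ae
  have hfat : ∫⁻ θ, negLogNN ‖F θ‖ ∂m ≤
      liminf (fun i => ∫⁻ θ, negLogNN ‖S (ns i) θ‖ ∂m) atTop := by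
    refine le_trans (lintegral_mono_ae ?_) (lintegral_liminf_le' fun i =>
      (negLogNN_meas.comp_aemeasurable (Lp.aestronglyMeasurable (S (ns i))).norm.aemeasurable))
    filter_upwards [hae] with θ hθ
    exact (negLogNN_tendsto (norm_nonneg _) hθ.norm).liminf_eq.ge
  obtain ⟨C, hC⟩ := hS.norm.bddAbove_range
  have hb : ∀ N, ∫⁻ θ, negLogNN ‖S N θ‖ ∂m ≤
      ENNReal.ofReal C + ENNReal.ofReal (-Real.log ‖d 0‖) := by
    intro N
    have hp : pp d N ≠ 0 := by
      intro h
      have := pp_lead d hd N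
      rw [h] at this
      exact hd (by simpa using this.symm)
    have h1 := poly_bound (pp d N) hp
    rw [pp_lead d hd] at h1
    have h2 : ∫⁻ θ, negLogNN ‖S N θ‖ ∂m = ∫⁻ θ, negLogNN ‖(pp d N).eval (pt θ)‖ ∂m :=
      lintegral_congr_ae ((hSae N).mono fun θ h => by simp only [h])
    have h3 : ∫⁻ θ, ‖S N θ‖ₑ ∂m = ∫⁻ θ, ‖(pp d N).eval (pt θ)‖ₑ ∂m :=
      lintegral_congr_ae ((hSae N).mono fun θ h => by simp only [← ofReal_norm, h])
    rw [h2]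
    refine h1.trans ?_
    gcongr
    rw [← h3, ← eLpNorm_one_eq_lintegral_enorm]
    refine (eLpNorm_le_eLpNorm_of_exponent_le (q := 2) (by norm_num)
      (Lp.aestronglyMeasurable (S N))).trans ?_
    rw [← Lp.enorm_def, ← ofReal_norm]
    exact ENNReal.ofReal_le_ofReal (hC ⟨N, rfl⟩)
  refine hfat.trans_lt ?_
  refine lt_of_le_of_lt (liminf_le_of_le (by isBoundedDefault) (a := ENNReal.ofReal C + ENNReal.ofReal (-Real.log ‖d 0‖)) ?_) (by simp)
  intro c hc
  obtain ⟨i, hi⟩ := hc.exists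
  exact hi.trans (hb _)

lemma pointwise_bound (x s : ℝ) (hx : 0 ≤ x) (hs : 0 ≤ s) :
    negLogNN (1 - s) ≤ ENNReal.ofReal (Real.log 2) + 2 * ENNReal.ofReal x +
      2 * negLogNN (x * Real.sqrt (1 - s ^ 2)) := by
  by_cases h : x * Real.sqrt (1 - s ^ 2) ≤ 0
  · have : negLogNN (x * Real.sqrt (1 - s ^ 2)) = ⊤ := if_pos h
    rw [this]; simp
  push Not at h
  have hsq : 0 < Real.sqrt (1 - s ^ 2) := by
    rcases (Real.sqrt_nonneg (1 - s ^ 2)).eq_or_lt with h' | h'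
    · rw [← h'] at h; simp at h
    · exact h'
  have hx0 : 0 < x := (pos_iff_pos_of_mul_pos h).2 hsq
  have h1 : 0 < 1 - s ^ 2 := Real.sqrt_pos.1 hsq
  have h2 : 0 < 1 - s := by nlinarith
  have h3 : Real.log (1 - s ^ 2) ≤ Real.log 2 + Real.log (1 - s) := by
    rw [← Real.log_mul (by norm_num) h2.ne']
    exact Real.log_le_log h1 (by nlinarith)
  rw [negLogNN, negLogNN, if_neg (not_le.2 h2), if_neg (not_le.2 h),
    Real.log_mul hx0.ne' hsq.ne', Real.log_sqrt h1.le]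
  have h4 := Real.log_le_self hx
  have e2 : (2 : ℝ≥0∞) = ENNReal.ofReal 2 := by simp
  rw [e2, ← ENNReal.ofReal_mul (by norm_num), ← ENNReal.ofReal_mul (by norm_num),
    ← ENNReal.ofReal_add (Real.log_nonneg (by norm_num)) (by positivity)]
  refine le_trans (ENNReal.ofReal_le_ofReal ?_) ENNReal.ofReal_add_le
  linarith

/-- **Vanishing of all moments of `g √(1-|b|²)` forces `g = 0` when `b` is an
extreme point.** -/
theorem moments_vanish_implies_zero
    -- `b` as an analytic function `B` on the unit disc, bounded by `1`:
    (B : ℂ → ℂ) (hBan : DifferentiableOn ℂ B (ball (0:ℂ) 1))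
    (hB1 : ∀ z ∈ ball (0:ℂ) 1, ‖B z‖ ≤ 1)
    -- its boundary function `b` on the circle (radial limits a.e.):
    (b : CircT → ℂ) (hbm : Measurable b)
    (hbdry : ∀ᵐ θ ∂m,
      Tendsto (fun r : ℝ => B ((r : ℂ) * pt θ)) (𝓝[<] (1:ℝ)) (𝓝 (b θ)))
    -- `b` is an extreme point of the unit ball: `∫ log(1-|b|) dm = -∞`:
    (hext : ∫⁻ θ, negLogNN (1 - ‖b θ‖) ∂m = ⊤)
    -- `g ∈ L²(E)`, i.e. `g ∈ L²(𝕋)` vanishing a.e. off `E = {|b| < 1}`: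
    (g : L2) (hgE : ∀ᵐ θ ∂m, ¬ ‖b θ‖ < 1 → g θ = 0)
    -- all nonnegative moments of `g √(1-|b|²)` vanish:
    (hmom : ∀ n : ℕ,
      ∫ θ, (starRingEnd ℂ) (pt θ) ^ n * g θ * (Real.sqrt (1 - ‖b θ‖^2) : ℂ) ∂m = 0) :
    g = 0 := by
  have hsqm : Measurable (fun θ => (Real.sqrt (1 - ‖b θ‖^2) : ℂ)) := by fun_prop
  have hsq1 : ∀ θ, ‖(Real.sqrt (1 - ‖b θ‖^2) : ℂ)‖ ≤ 1 := by
    intro θ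
    rw [Complex.norm_real, Real.norm_of_nonneg (Real.sqrt_nonneg _), Real.sqrt_le_one]
    nlinarith [sq_nonneg ‖b θ‖]
  have hmem : MemLp (fun θ => g θ * (Real.sqrt (1 - ‖b θ‖^2) : ℂ)) 2 m := by
    refine (Lp.memLp g).mono ((Lp.aestronglyMeasurable g).mul hsqm.aestronglyMeasurable) ?_
    filter_upwards [] with θ
    rw [norm_mul]
    exact mul_le_of_le_one_right (norm_nonneg _) (hsq1 θ)
  have hco := hmem.coeFn_toLp
  set F : L2 := hmem.toLp _ with hFdef
  have hF : ∀ n : ℕ, fourierCoeff F (n : ℤ) = 0 := by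
    intro n
    rw [← hmom n, fourierCoeff]
    refine integral_congr_ae ?_
    filter_upwards [hco] with θ hθ
    simp only [hθ, smul_eq_mul, fourier_pt, mul_assoc]
  have hF0 : F = 0 := by
    by_contra hne
    have hk := key F hF hne
    have hgi : ∫⁻ θ, ENNReal.ofReal ‖g θ‖ ∂m < ⊤ := by
      have : Integrable g m := (Lp.memLp g).integrable (by norm_num)
      simp only [ofReal_norm]
      exact this.2
    have hle : ∫⁻ θ, negLogNN (1 - ‖b θ‖) ∂m ≤
        ∫⁻ θ, (ENNReal.ofReal (Real.log 2) + 2 * ENNReal.ofReal ‖g θ‖ + 2 * negLogNN ‖F θ‖) ∂m := by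
      apply lintegral_mono_ae
      filter_upwards [hco] with θ hθ
      have := pointwise_bound ‖g θ‖ ‖b θ‖ (norm_nonneg _) (norm_nonneg _)
      rw [hθ, norm_mul, Complex.norm_real, Real.norm_of_nonneg (Real.sqrt_nonneg _)]
      exact this
    have hgm : AEMeasurable (fun θ => ENNReal.ofReal ‖g θ‖) m :=
      (Lp.aestronglyMeasurable g).norm.aemeasurable.ennreal_ofReal
    rw [hext, lintegral_add_left' (by fun_prop), lintegral_add_left' (by fun_prop),
      lintegral_const_mul' _ _ (by simp), lintegral_const_mul' _ _ (by simp)] at hle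
    refine absurd hle (not_le.2 ?_)
    simp only [lintegral_const, measure_univ, mul_one]
    exact ENNReal.add_lt_top.2 ⟨ENNReal.add_lt_top.2 ⟨by simp,
      ENNReal.mul_lt_top (by simp) hgi⟩, ENNReal.mul_lt_top (by simp) hk⟩
  rw [Lp.eq_zero_iff_ae_eq_zero] at hF0 ⊢
  filter_upwards [hF0, hco, hgE] with θ h1 h2 h3
  rw [h2] at h1
  by_cases hb : ‖b θ‖ < 1
  · have : 0 < 1 - ‖b θ‖ ^ 2 := by nlinarith [norm_nonneg (b θ)]
    have h4 : Real.sqrt (1 - ‖b θ‖ ^ 2) ≠ 0 := (Real.sqrt_pos.2 this).ne'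
    have h5 : (Real.sqrt (1 - ‖b θ‖ ^ 2) : ℂ) ≠ 0 := by exact_mod_cast h4
    exact (mul_eq_zero.1 h1).resolve_right h5
  · exact h3 hb
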